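/- If the boundary data satisfies ⟨gⁱ, qⁱ⟩ = 0 for every i ∈ I (as holds for shear data gⁱ = γ·e₁ for i ∈ I⁺ and gⁱ = −γ·e₁ for i ∈ I⁻, since qⁱ = ±e₂), then the infimum of the full dissipation functional Q over all (T, ω) ∈ (ℝ²)^N × ℝ^N satisfies inf Q ≤ δ^{−1/2}·Σ_{i∈I} C^i_sh·⟨gⁱ, pⁱ⟩². In particular, for the shear data gⁱ = ±γ·e₁ this bound equals δ^{−1/2}·γ²·Σ_{i∈I} C^i_sh, so the discrete dissipation rate E_net = inf Q blows up at most at the rate δ^{−1/2} as δ → 0 (weak blow up of the effective shear viscosity). -/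

import Mathlib

noncomputable section

/-- Dot product on ℝ² (represented as `Fin 2 → ℝ`). -/
def dot (v w : Fin 2 → ℝ) : ℝ := v 0 * w 0 + v 1 * w 1

/-- First standard basis vector of ℝ². -/
def e1 : Fin 2 → ℝ := ![1, 0]

/-- Second standard basis vector of ℝ². -/
def e2 : Fin 2 → ℝ := ![0, 1]

/-- Clockwise rotation by π/2: (q₁, q₂) ↦ (q₂, −q₁). -/
def perp (v : Fin 2 → ℝ) : Fin 2 → ℝ := ![v 1, -v 0]

/-- if the boundary data satisfies ⟨gⁱ, qⁱ⟩ = 0 on I, then the infimum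
of the full dissipation functional Q satisfies
inf Q ≤ δ^{-1/2} Σ_{i∈I} C^i_sh ⟨gⁱ, pⁱ⟩²; in particular, for shear data
gⁱ = ±γ e₁ the bound equals δ^{-1/2} γ² Σ_{i∈I} C^i_sh (weak blow up). -/
theorem stmt3
    (N : ℕ)
    (adj : Fin N → Fin N → Prop) [DecidableRel adj]
    (hsymm : ∀ i j, adj i j → adj j i)
    (hirrefl : ∀ i, ¬ adj i i)
    (q : Fin N → Fin N → Fin 2 → ℝ)
    (hq_unit : ∀ i j, adj i j → dot (q i j) (q i j) = 1)
    (hq_anti : ∀ i j, adj i j → q j i = -q i j)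
    (Iplus Iminus : Finset (Fin N))
    (hdisj : Disjoint Iplus Iminus)
    (qb : Fin N → Fin 2 → ℝ)
    (hqb_plus : ∀ i ∈ Iplus, qb i = e2)
    (hqb_minus : ∀ i ∈ Iminus, qb i = -e2)
    (Csp Csh Crot : Fin N → Fin N → ℝ)
    (hCsp_symm : ∀ i j, Csp i j = Csp j i)
    (hCsh_symm : ∀ i j, Csh i j = Csh j i)
    (hCrot_symm : ∀ i j, Crot i j = Crot j i)
    (hCsp_pos : ∀ i j, adj i j → 0 < Csp i j)
    (hCsh_pos : ∀ i j, adj i j → 0 < Csh i j)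
    (hCrot_pos : ∀ i j, adj i j → 0 < Crot i j)
    (Cbsp Cbsh Cbrot : Fin N → ℝ)
    (hCbsp_pos : ∀ i ∈ Iplus ∪ Iminus, 0 < Cbsp i)
    (hCbsh_pos : ∀ i ∈ Iplus ∪ Iminus, 0 < Cbsh i)
    (hCbrot_pos : ∀ i ∈ Iplus ∪ Iminus, 0 < Cbrot i)
    (a : ℝ) (ha : 0 < a)
    (δ : ℝ) (hδ : 0 < δ)
    (g : Fin N → Fin 2 → ℝ)
    (hg : ∀ i ∈ Iplus ∪ Iminus, dot (g i) (qb i) = 0)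
    (Q : (Fin N → Fin 2 → ℝ) → (Fin N → ℝ) → ℝ)
    (hQ : ∀ T ω, Q T ω =
      (1/2) * ∑ i, ∑ j, (if adj i j then
          δ ^ (-(3:ℝ)/2) * Csp i j * (dot (T i - T j) (q i j))^2
          + δ ^ (-(1:ℝ)/2) * Csh i j *
              (dot (T i - T j) (perp (q i j)) + a * ω i + a * ω j)^2
          + δ ^ (-(1:ℝ)/2) * Crot i j * a^2 * (ω i - ω j)^2
        else 0)
      + ∑ i ∈ Iplus ∪ Iminus,
          (δ ^ (-(3:ℝ)/2) * Cbsp i * (dot (T i - g i) (qb i))^2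
          + δ ^ (-(1:ℝ)/2) * Cbrot i * a^2 * (2 * ω i)^2
          + δ ^ (-(1:ℝ)/2) * Cbsh i * (dot (T i - g i) (perp (qb i)) + a * ω i)^2)) :
    (⨅ p : (Fin N → Fin 2 → ℝ) × (Fin N → ℝ), Q p.1 p.2)
      ≤ δ ^ (-(1:ℝ)/2) * ∑ i ∈ Iplus ∪ Iminus, Cbsh i * (dot (g i) (perp (qb i)))^2 ∧
    (∀ γ : ℝ, (∀ i ∈ Iplus, g i = γ • e1) → (∀ i ∈ Iminus, g i = (-γ) • e1) →
      (⨅ p : (Fin N → Fin 2 → ℝ) × (Fin N → ℝ), Q p.1 p.2)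
        ≤ δ ^ (-(1:ℝ)/2) * γ^2 * ∑ i ∈ Iplus ∪ Iminus, Cbsh i) := by
  have hQ_nonneg : ∀ p : (Fin N → Fin 2 → ℝ) × (Fin N → ℝ), 0 ≤ Q p.1 p.2 := by
    intro p
    rw [hQ]
    refine add_nonneg (mul_nonneg (by norm_num)
      (Finset.sum_nonneg fun i _ => Finset.sum_nonneg fun j _ => ?_))
      (Finset.sum_nonneg fun i hi => ?_)
    · split_ifs with h
      · have h1 := hCsp_pos i j h
        have h2 := hCsh_pos i j h
        have h3 := hCrot_pos i j h
        positivity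
      · exact le_rfl
    · have h1 := hCbsp_pos i hi
      have h2 := hCbsh_pos i hi
      have h3 := hCbrot_pos i hi
      positivity
  have hQ_zero : Q 0 0 =
      δ ^ (-(1:ℝ)/2) * ∑ i ∈ Iplus ∪ Iminus, Cbsh i * (dot (g i) (perp (qb i)))^2 := by
    have hdot_zero : ∀ v, dot 0 v = 0 := fun v => by simp [dot]
    have hdot_neg : ∀ v w, dot (-v) w = -dot v w := fun v w => by
      simp only [dot, Pi.neg_apply]; ring
    rw [hQ]
    simp only [Pi.zero_apply, sub_zero, zero_sub, hdot_zero, hdot_neg]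
    simp only [mul_zero, add_zero, ne_eq, OfNat.ofNat_ne_zero, not_false_eq_true, zero_pow,
      ite_self, Finset.sum_const_zero, zero_add, neg_sq]
    rw [Finset.mul_sum]
    refine Finset.sum_congr rfl fun i hi => ?_
    rw [hg i hi]
    ring
  have hbound : (⨅ p : (Fin N → Fin 2 → ℝ) × (Fin N → ℝ), Q p.1 p.2)
      ≤ δ ^ (-(1:ℝ)/2) * ∑ i ∈ Iplus ∪ Iminus, Cbsh i * (dot (g i) (perp (qb i)))^2 :=
    hQ_zero ▸ ciInf_le ⟨0, Set.forall_mem_range.2 hQ_nonneg⟩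
      ((0, 0) : (Fin N → Fin 2 → ℝ) × (Fin N → ℝ))
  refine ⟨hbound, fun γ hplus hminus => hbound.trans_eq ?_⟩
  rw [mul_assoc, Finset.mul_sum _ _ (γ ^ 2)]
  congr 1
  refine Finset.sum_congr rfl fun i hi => ?_
  rcases Finset.mem_union.1 hi with h | h
  · rw [hplus i h, hqb_plus i h]
    simp [dot, perp, e1, e2, mul_comm]
  · rw [hminus i h, hqb_minus i h]
    simp [dot, perp, e1, e2, mul_comm]
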